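/- Consider the relaxed stochastic bin packing problem on empty machines: fix N, K ∈ ℕ, capacity V > 0, coefficient D > 0, means μ ∈ ℝ^K with μ_j ≥ 0, uncertainties b ∈ ℝ^K with b_j > 0 for all j, and demands m ∈ ℝ^K with m_j ≥ 0. If x* is feasible and minimizes UCaC(x) over all feasible allocations x, then there do not exist two distinct machine indices i ≠ i' that are both used by x* and both not full, i.e., with g_i(x*) < V and g_{i'}(x*) < V; equivalently, at most one used machine is not full at UCaC optimality. -/

import Mathlib

open Finset

/-- Resource usage `g_i(x) = Σ_j x_{ij} μ_j + D·√(Σ_j x_{ij} b_j)` of machine `i`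
under the (relaxed, real-valued) allocation `x`. -/
noncomputable def machineUsage {N K : ℕ} (D : ℝ) (μ b : Fin K → ℝ)
    (x : Fin N → Fin K → ℝ) (i : Fin N) : ℝ :=
  (∑ j, x i j * μ j) + D * Real.sqrt (∑ j, x i j * b j)

/-- Feasibility of a relaxed allocation `x` on empty machines: nonnegative entries,
per-machine capacity constraint, and all demands satisfied. -/
noncomputable def FeasibleAlloc {N K : ℕ} (V D : ℝ) (μ b m : Fin K → ℝ)
    (x : Fin N → Fin K → ℝ) : Prop :=
  (∀ i j, 0 ≤ x i j) ∧ (∀ i, machineUsage D μ b x i ≤ V) ∧ (∀ j, ∑ i, x i j = m j)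

/-- The cluster UCaC of an allocation: the sum of machine usages. -/
noncomputable def clusterUCaC {N K : ℕ} (D : ℝ) (μ b : Fin K → ℝ)
    (x : Fin N → Fin K → ℝ) : ℝ :=
  ∑ i, machineUsage D μ b x i

/-- Shifting a fraction `t` from the smaller to the larger argument strictly
decreases the sum of square roots. -/
lemma sqrt_shift_lt (B B' t : ℝ) (hB' : 0 < B') (h : B' ≤ B) (ht : 0 < t) (ht1 : t < 1) :
    Real.sqrt (B + t * B') + Real.sqrt ((1 - t) * B') < Real.sqrt B + Real.sqrt B' := by
  have hB : 0 < B := by linarith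
  have h1 : 0 ≤ B + t * B' := by positivity
  have h2 : 0 ≤ (1 - t) * B' := mul_nonneg (by linarith) hB'.le
  have hprod : Real.sqrt (B + t * B') * Real.sqrt ((1 - t) * B')
      < Real.sqrt B * Real.sqrt B' := by
    rw [← Real.sqrt_mul h1, ← Real.sqrt_mul hB.le]
    apply Real.sqrt_lt_sqrt (mul_nonneg h1 h2)
    have e : B * B' - (B + t * B') * ((1 - t) * B')
        = t * B' * (B - B') + t * t * B' * B' := by ring
    have p1 : 0 ≤ t * B' * (B - B') := mul_nonneg (by positivity) (by linarith)
    have p2 : 0 < t * t * B' * B' := by positivity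
    linarith
  apply lt_of_pow_lt_pow_left₀ 2 (by positivity)
  have := Real.sq_sqrt h1
  have := Real.sq_sqrt h2
  have := Real.sq_sqrt hB.le
  have := Real.sq_sqrt hB'.le
  nlinarith

lemma no_pair_aux (N K : ℕ) (V D : ℝ) (hD : 0 < D)
    (μ b m : Fin K → ℝ) (hμ : ∀ j, 0 ≤ μ j) (hb : ∀ j, 0 < b j)
    (xs : Fin N → Fin K → ℝ) (hx : FeasibleAlloc V D μ b m xs)
    (hopt : ∀ x : Fin N → Fin K → ℝ, FeasibleAlloc V D μ b m x →
      clusterUCaC D μ b xs ≤ clusterUCaC D μ b x)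
    (i i' : Fin N) (hne : i ≠ i') (hu : ∃ j, xs i' j ≠ 0)
    (hi : machineUsage D μ b xs i < V)
    (hle : ∑ j, xs i' j * b j ≤ ∑ j, xs i j * b j) : False := by
  obtain ⟨hx0, hxV, hxm⟩ := hx
  set A := ∑ j, xs i j * μ j with hA
  set A' := ∑ j, xs i' j * μ j with hA'
  set B := ∑ j, xs i j * b j with hB
  set B' := ∑ j, xs i' j * b j with hB'
  have hB'pos : 0 < B' := by
    obtain ⟨j, hj⟩ := hu
    apply Finset.sum_pos' (fun k _ => mul_nonneg (hx0 _ _) (hb k).le)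
    exact ⟨j, Finset.mem_univ _, mul_pos (lt_of_le_of_ne (hx0 _ _) (Ne.symm hj)) (hb j)⟩
  have hA'0 : 0 ≤ A' := Finset.sum_nonneg (fun k _ => mul_nonneg (hx0 _ _) (hμ k))
  have hus : machineUsage D μ b xs i = A + D * Real.sqrt B := rfl
  have hus' : machineUsage D μ b xs i' = A' + D * Real.sqrt B' := rfl
  obtain ⟨t, ht0, ht1, htV⟩ : ∃ t : ℝ, 0 < t ∧ t < 1 ∧
      A + t * A' + D * Real.sqrt (B + t * B') < V := by
    have hc : Continuous (fun t : ℝ => A + t * A' + D * Real.sqrt (B + t * B')) := by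
      fun_prop
    have h0 : (fun t : ℝ => A + t * A' + D * Real.sqrt (B + t * B')) 0 < V := by
      simpa [hus] using hi
    have hev := (hc.tendsto 0).eventually (gt_mem_nhds h0)
    obtain ⟨ε, hε, hball⟩ := Metric.eventually_nhds_iff.mp hev
    refine ⟨min (ε / 2) (1 / 2), by positivity, ?_, ?_⟩
    · exact lt_of_le_of_lt (min_le_right _ _) (by norm_num)
    · apply hball
      rw [Real.dist_eq, sub_zero, abs_of_pos (by positivity)]
      exact lt_of_le_of_lt (min_le_left _ _) (by linarith)
  let x : Fin N → Fin K → ℝ := fun k j =>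
    xs k j + ((if k = i then t * xs i' j else 0) - (if k = i' then t * xs i' j else 0))
  have xi : ∀ j, x i j = xs i j + t * xs i' j := fun j => by simp [x, hne]
  have xi' : ∀ j, x i' j = (1 - t) * xs i' j := fun j => by
    simp [x, hne.symm]; ring
  have xo : ∀ k, k ≠ i → k ≠ i' → ∀ j, x k j = xs k j := fun k h h' j => by simp [x, h, h']
  have gi : machineUsage D μ b x i = A + t * A' + D * Real.sqrt (B + t * B') := by
    simp only [machineUsage, xi, hA, hA', hB, hB', Finset.mul_sum, ← Finset.sum_add_distrib,
      add_mul, mul_assoc]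
  have gi' : machineUsage D μ b x i' = (1 - t) * A' + D * Real.sqrt ((1 - t) * B') := by
    simp only [machineUsage, xi', hA', hB', Finset.mul_sum, mul_assoc]
  have go : ∀ k, k ≠ i → k ≠ i' → machineUsage D μ b x k = machineUsage D μ b xs k :=
    fun k h h' => by simp only [machineUsage, xo k h h']
  have key := sqrt_shift_lt B B' t hB'pos hle ht0 ht1
  have hfeas : FeasibleAlloc V D μ b m x := by
    refine ⟨fun k j => ?_, fun k => ?_, fun j => ?_⟩
    · by_cases h : k = i
      · subst h; rw [xi]; exact add_nonneg (hx0 _ _) (mul_nonneg ht0.le (hx0 _ _))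
      by_cases h' : k = i'
      · subst h'; rw [xi']; exact mul_nonneg (by linarith) (hx0 _ _)
      rw [xo k h h']; exact hx0 _ _
    · by_cases h : k = i
      · subst h; rw [gi]; exact htV.le
      by_cases h' : k = i'
      · subst h'
        rw [gi']
        have h3 := hxV k
        rw [hus'] at h3
        have h4 : Real.sqrt ((1 - t) * B') ≤ Real.sqrt B' :=
          Real.sqrt_le_sqrt (by nlinarith)
        have h5 := mul_le_mul_of_nonneg_left h4 hD.le
        have h6 := mul_nonneg ht0.le hA'0
        linarith
      rw [go k h h']; exact hxV _
    · simp only [x, Finset.sum_add_distrib, Finset.sum_sub_distrib, Finset.sum_ite_eq',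
        Finset.mem_univ, if_true, sub_self, add_zero]
      exact hxm j
  have hdiff : ∑ k, (machineUsage D μ b x k - machineUsage D μ b xs k)
      = (machineUsage D μ b x i - machineUsage D μ b xs i)
        + (machineUsage D μ b x i' - machineUsage D μ b xs i') := by
    apply Finset.sum_eq_add i i' hne
    · intro k _ hk
      rw [go k hk.1 hk.2, sub_self]
    · intro h; exact absurd (Finset.mem_univ _) h
    · intro h; exact absurd (Finset.mem_univ _) h
  rw [Finset.sum_sub_distrib, gi, gi', hus, hus'] at hdiff
  have ho := hopt x hfeas
  unfold clusterUCaC at ho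
  have := mul_lt_mul_of_pos_left key hD
  linarith

/-- At UCaC optimality of the relaxed SBPP on empty machines, at most one used machine
is not full: there are no two distinct used machines `i ≠ i'` with
`g_i(x*) < V` and `g_{i'}(x*) < V`. -/
theorem at_most_one_not_full (N K : ℕ) (V D : ℝ) (hV : 0 < V) (hD : 0 < D)
    (μ b m : Fin K → ℝ) (hμ : ∀ j, 0 ≤ μ j) (hb : ∀ j, 0 < b j) (hm : ∀ j, 0 ≤ m j)
    (xstar : Fin N → Fin K → ℝ) (hxstar : FeasibleAlloc V D μ b m xstar)
    (hopt : ∀ x : Fin N → Fin K → ℝ, FeasibleAlloc V D μ b m x →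
      clusterUCaC D μ b xstar ≤ clusterUCaC D μ b x) :
    ¬ ∃ i i' : Fin N, i ≠ i' ∧ (∃ j, xstar i j ≠ 0) ∧ (∃ j, xstar i' j ≠ 0) ∧
      machineUsage D μ b xstar i < V ∧ machineUsage D μ b xstar i' < V := by
  rintro ⟨i, i', hne, hu, hu', hi, hi'⟩
  rcases le_total (∑ j, xstar i' j * b j) (∑ j, xstar i j * b j) with h | h
  · exact no_pair_aux N K V D hD μ b m hμ hb xstar hxstar hopt i i' hne hu' hi h
  · exact no_pair_aux N K V D hD μ b m hμ hb xstar hxstar hopt i' i hne.symm hu hi' h
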